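/- Let (α_N)_{N ∈ ℕ} be a bounded sequence of nonzero real numbers such that α_N² · log N → ∞ as N → ∞, and for each N let λ_N > 0 be the unique positive solution of λ_N = (3α_N²/(8π²)) · ∑_{n ∈ ℤ², |n| ≤ N} 1/(λ_N + |n|²). Then there exist a constant C > 0 and N₀ ≥ 3 such that for all N ≥ N₀, |λ_N − (3/(4π))·α_N²·log N| ≤ C · α_N² · log log N. -/

import Mathlib

open scoped BigOperators

/- The set of lattice points `n ∈ ℤ²` with Euclidean norm `|n| ≤ N`. -/
open scoped Classical in
noncomputable def latticeBall (N : ℝ) : Finset (ℤ × ℤ) :=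
  (Finset.Icc (⌈-N⌉ : ℤ) ⌊N⌋ ×ˢ Finset.Icc (⌈-N⌉ : ℤ) ⌊N⌋).filter
    fun n => ((n.1 : ℝ) ^ 2 + (n.2 : ℝ) ^ 2) ≤ N ^ 2

/-- The half-open unit square of the plane with lower left corner `n`. -/
def unitCell (n : ℤ × ℤ) : Set (ℝ × ℝ) :=
  Set.Ico (n.1 : ℝ) (n.1 + 1) ×ˢ Set.Ico (n.2 : ℝ) (n.2 + 1)

/-- The Euclidean distance of a point of the plane to the origin. -/
noncomputable def radius (p : ℝ × ℝ) : ℝ := √(p.1 ^ 2 + p.2 ^ 2)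

lemma continuous_radius : Continuous radius := by
  unfold radius; fun_prop

lemma radius_nonneg (p : ℝ × ℝ) : 0 ≤ radius p := Real.sqrt_nonneg _

lemma radius_sq (p : ℝ × ℝ) : radius p ^ 2 = p.1 ^ 2 + p.2 ^ 2 :=
  Real.sq_sqrt (by positivity)

lemma radius_triangle (p q : ℝ × ℝ) : radius (p + q) ≤ radius p + radius q := by
  have hp := radius_nonneg p
  have hq := radius_nonneg q
  refine abs_le_of_sq_le_sq' ?_ (by positivity) |>.2
  have hcs : p.1 * q.1 + p.2 * q.2 ≤ radius p * radius q := by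
    refine abs_le_of_sq_le_sq' ?_ (by positivity) |>.2
    rw [mul_pow, radius_sq, radius_sq]
    nlinarith [sq_nonneg (p.1 * q.2 - p.2 * q.1)]
  have := radius_sq p
  have := radius_sq q
  have h := radius_sq (p + q)
  simp only [Prod.fst_add, Prod.snd_add] at h
  nlinarith

lemma radius_le_two {p : ℝ × ℝ} (h₁ : |p.1| ≤ 1) (h₂ : |p.2| ≤ 1) : radius p ≤ 2 := by
  refine abs_le_of_sq_le_sq' ?_ (by norm_num) |>.2
  rw [radius_sq]
  have := sq_le_one_iff_abs_le_one p.1 |>.2 h₁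
  have := sq_le_one_iff_abs_le_one p.2 |>.2 h₂
  linarith

lemma abs_radius_sub_le_two {n : ℤ × ℤ} {p : ℝ × ℝ} (hp : p ∈ unitCell n) :
    |radius p - radius (n.1, n.2)| ≤ 2 := by
  obtain ⟨⟨h₁, h₂⟩, h₃, h₄⟩ := hp
  rw [abs_le]
  constructor
  · have h := radius_triangle p (n.1 - p.1, n.2 - p.2)
    have h' : radius (n.1 - p.1, n.2 - p.2) ≤ 2 :=
      radius_le_two (by rw [abs_le]; constructor <;> simp <;> linarith)
        (by rw [abs_le]; constructor <;> simp <;> linarith)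
    have e : p + ((n.1 : ℝ) - p.1, (n.2 : ℝ) - p.2) = ((n.1 : ℝ), (n.2 : ℝ)) := by
      ext <;> simp
    rw [e] at h
    linarith
  · have h := radius_triangle (n.1, n.2) (p.1 - n.1, p.2 - n.2)
    have h' : radius (p.1 - n.1, p.2 - n.2) ≤ 2 :=
      radius_le_two (by rw [abs_le]; constructor <;> simp <;> linarith)
        (by rw [abs_le]; constructor <;> simp <;> linarith)
    have e : ((n.1 : ℝ), (n.2 : ℝ)) + (p.1 - n.1, p.2 - n.2) = p := by ext <;> simp
    rw [e] at h
    linarith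

lemma mem_unitCell_floor (p : ℝ × ℝ) : p ∈ unitCell (⌊p.1⌋, ⌊p.2⌋) :=
  ⟨⟨Int.floor_le _, Int.lt_floor_add_one _⟩, Int.floor_le _, Int.lt_floor_add_one _⟩

lemma measurableSet_unitCell (n : ℤ × ℤ) : MeasurableSet (unitCell n) :=
  measurableSet_Ico.prod measurableSet_Ico

lemma volume_unitCell (n : ℤ × ℤ) : MeasureTheory.volume (unitCell n) = 1 := by
  simp [unitCell, MeasureTheory.Measure.volume_eq_prod, MeasureTheory.Measure.prod_prod]

lemma disjoint_unitCell {m n : ℤ × ℤ} (h : m ≠ n) : Disjoint (unitCell m) (unitCell n) := by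
  rw [Set.disjoint_left]
  rintro p ⟨hm₁, hm₂⟩ ⟨hn₁, hn₂⟩
  apply h
  have e₁ : m.1 = n.1 := by
    rw [← Int.floor_eq_iff.2 hm₁, ← Int.floor_eq_iff.2 hn₁]
  have e₂ : m.2 = n.2 := by
    rw [← Int.floor_eq_iff.2 hm₂, ← Int.floor_eq_iff.2 hn₂]
  exact Prod.ext e₁ e₂

lemma mem_latticeBall {N : ℝ} (hN : 0 ≤ N) {n : ℤ × ℤ} :
    n ∈ latticeBall N ↔ radius (n.1, n.2) ≤ N := by
  have h : radius (n.1, n.2) ≤ N ↔ (n.1 : ℝ) ^ 2 + (n.2 : ℝ) ^ 2 ≤ N ^ 2 :=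
    Real.sqrt_le_left hN
  rw [h]
  simp only [latticeBall, Finset.mem_filter, Finset.mem_product, Finset.mem_Icc, Int.ceil_le,
    Int.le_floor, and_iff_right_iff_imp]
  intro h
  exact ⟨abs_le_of_sq_le_sq' (by nlinarith [sq_nonneg (n.2 : ℝ)]) hN,
    abs_le_of_sq_le_sq' (by nlinarith [sq_nonneg (n.1 : ℝ)]) hN⟩

lemma integrable_radial {g : ℝ → ℝ} (hg : Continuous g) (R : ℝ) :
    MeasureTheory.Integrable fun p => (Set.Iic R).indicator g (radius p) := by
  have hc : IsClosed (radius ⁻¹' Set.Iic R) := isClosed_Iic.preimage continuous_radius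
  have hK : IsCompact (radius ⁻¹' Set.Iic R) := by
    refine (isCompact_Icc (a := ((-R, -R) : ℝ × ℝ)) (b := (R, R))).of_isClosed_subset hc ?_
    intro p hp
    have hp : radius p ≤ R := hp
    have hR : 0 ≤ R := (radius_nonneg p).trans hp
    have hsq : p.1 ^ 2 + p.2 ^ 2 ≤ R ^ 2 := (Real.sqrt_le_left hR).1 hp
    have h₁ := abs_le_of_sq_le_sq' (a := p.1) (b := R) (by nlinarith [sq_nonneg p.2]) hR
    have h₂ := abs_le_of_sq_le_sq' (a := p.2) (b := R) (by nlinarith [sq_nonneg p.1]) hR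
    exact ⟨⟨h₁.1, h₂.1⟩, h₁.2, h₂.2⟩
  exact (MeasureTheory.integrable_indicator_iff hc.measurableSet).2
    ((hg.comp continuous_radius).continuousOn.integrableOn_compact hK)

lemma integral_radial (g : ℝ → ℝ) {R : ℝ} (hR : 0 ≤ R) :
    ∫ p, (Set.Iic R).indicator g (radius p) = 2 * Real.pi * ∫ r in (0 : ℝ)..R, r * g r := by
  rw [← integral_comp_polarCoord_symm]
  have e : ∀ p ∈ polarCoord.target,
      p.1 • (Set.Iic R).indicator g (radius (polarCoord.symm p)) =
        (Set.Iic R).indicator (fun r => r * g r) p.1 * 1 := by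
    rintro ⟨r, θ⟩ ⟨hr, -⟩
    have hr : 0 < r := hr
    have : radius (polarCoord.symm (r, θ)) = r := by
      rw [radius, polarCoord_symm_apply, ← Real.sqrt_sq hr.le]
      congr 1
      simp only [Real.sqrt_sq hr.le]
      nlinarith [Real.sin_sq_add_cos_sq θ]
    rw [this]
    by_cases h : r ≤ R <;> simp [Set.indicator, h]
  rw [MeasureTheory.setIntegral_congr_fun polarCoord.open_target.measurableSet e,
    polarCoord_target, MeasureTheory.Measure.volume_eq_prod,
    MeasureTheory.setIntegral_prod_mul _ (fun _ : ℝ => (1 : ℝ)),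
    MeasureTheory.setIntegral_indicator measurableSet_Iic, Set.Ioi_inter_Iic,
    ← intervalIntegral.integral_of_le hR]
  have : (∫ _ in Set.Ioo (-Real.pi) Real.pi, (1 : ℝ)) = 2 * Real.pi := by
    simp [Real.pi_pos.le]; ring
  rw [this]; ring

lemma setIntegral_biUnion_unitCell {F : ℝ × ℝ → ℝ} (hF : MeasureTheory.Integrable F)
    (s : Finset (ℤ × ℤ)) :
    ∫ p in ⋃ n ∈ s, unitCell n, F p = ∑ n ∈ s, ∫ p in unitCell n, F p :=
  MeasureTheory.integral_biUnion_finset s (fun n _ => measurableSet_unitCell n)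
    (fun _ _ _ _ h => disjoint_unitCell h) (fun _ _ => hF.integrableOn)

lemma setIntegral_unitCell_const (n : ℤ × ℤ) (c : ℝ) : ∫ _ in unitCell n, c = c := by
  simp [MeasureTheory.measureReal_def, volume_unitCell]

lemma integrableOn_unitCell_const (n : ℤ × ℤ) (c : ℝ) :
    MeasureTheory.IntegrableOn (fun _ => c) (unitCell n) :=
  MeasureTheory.integrableOn_const (by simp [volume_unitCell])

lemma sum_latticeBall_le {N : ℝ} (hN : 0 ≤ N) {f g : ℝ → ℝ} (hg : Continuous g)
    (hg₀ : ∀ r, 0 ≤ g r) (hfg : ∀ m r, 0 ≤ m → 0 ≤ r → |r - m| ≤ 2 → f m ≤ g r) :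
    ∑ n ∈ latticeBall N, f (radius (n.1, n.2)) ≤
      2 * Real.pi * ∫ r in (0 : ℝ)..(N + 2), r * g r := by
  rw [← integral_radial g (by linarith : 0 ≤ N + 2)]
  have hF := integrable_radial hg (N + 2)
  calc _ ≤ ∑ n ∈ latticeBall N, ∫ p in unitCell n, (Set.Iic (N + 2)).indicator g (radius p) := by
        refine Finset.sum_le_sum fun n hn => ?_
        rw [← setIntegral_unitCell_const n (f _)]
        refine MeasureTheory.setIntegral_mono_on (integrableOn_unitCell_const _ _)
          hF.integrableOn (measurableSet_unitCell n) fun p hp => ?_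
        have h := abs_radius_sub_le_two hp
        have hn := (mem_latticeBall hN).1 hn
        rw [Set.indicator_of_mem (by simp only [Set.mem_Iic]; linarith [(abs_le.1 h).2])]
        exact hfg _ _ (radius_nonneg _) (radius_nonneg _) h
    _ = _ := (setIntegral_biUnion_unitCell hF _).symm
    _ ≤ _ := MeasureTheory.setIntegral_le_integral hF
        (Filter.Eventually.of_forall fun p => Set.indicator_nonneg (fun r _ => hg₀ r) _)

lemma le_sum_latticeBall {N : ℝ} (hN : 2 ≤ N) {f g : ℝ → ℝ} (hg : Continuous g)
    (hf₀ : ∀ r, 0 ≤ f r) (hfg : ∀ m r, 0 ≤ m → 0 ≤ r → |r - m| ≤ 2 → g r ≤ f m) :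
    2 * Real.pi * ∫ r in (0 : ℝ)..(N - 2), r * g r ≤
      ∑ n ∈ latticeBall N, f (radius (n.1, n.2)) := by
  rw [← integral_radial g (by linarith : 0 ≤ N - 2)]
  have hF := integrable_radial hg (N - 2)
  have hN₀ : 0 ≤ N := by linarith
  calc _ = ∫ p in ⋃ n ∈ latticeBall N, unitCell n, (Set.Iic (N - 2)).indicator g (radius p) := by
        refine (MeasureTheory.setIntegral_eq_integral_of_forall_compl_eq_zero fun p hp => ?_).symm
        refine Set.indicator_of_notMem (fun h => hp ?_) _
        have h : radius p ≤ N - 2 := h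
        refine Set.mem_biUnion ((mem_latticeBall hN₀).2 ?_) (mem_unitCell_floor p)
        linarith [(abs_le.1 (abs_radius_sub_le_two (mem_unitCell_floor p))).1]
    _ = _ := setIntegral_biUnion_unitCell hF _
    _ ≤ _ := by
        refine Finset.sum_le_sum fun n hn => ?_
        rw [← setIntegral_unitCell_const n (f _)]
        refine MeasureTheory.setIntegral_mono_on hF.integrableOn
          (integrableOn_unitCell_const _ _) (measurableSet_unitCell n) fun p hp => ?_
        refine Set.indicator_apply_le' (fun _ => ?_) (fun _ => hf₀ _)
        exact hfg _ _ (radius_nonneg _) (radius_nonneg _) (abs_radius_sub_le_two hp)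

lemma integral_mul_inv_sq_add_sq {s : ℝ} (hs : 0 < s) (c a b : ℝ) :
    ∫ r in a..b, r * (1 / (s ^ 2 + (r + c) ^ 2)) =
      (Real.log (s ^ 2 + (b + c) ^ 2) / 2 - c / s * Real.arctan ((b + c) / s)) -
      (Real.log (s ^ 2 + (a + c) ^ 2) / 2 - c / s * Real.arctan ((a + c) / s)) := by
  have hpos : ∀ r : ℝ, 0 < s ^ 2 + (r + c) ^ 2 := fun r => by positivity
  refine intervalIntegral.integral_eq_sub_of_hasDerivAt
    (f := fun r => Real.log (s ^ 2 + (r + c) ^ 2) / 2 - c / s * Real.arctan ((r + c) / s))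
    (fun r _ => ?_) (Continuous.intervalIntegrable ?_ _ _)
  · have h₀ : HasDerivAt (fun r : ℝ => r + c) 1 r := (hasDerivAt_id r).add_const c
    have h₁ := (((h₀.pow 2).const_add (s ^ 2)).log (hpos r).ne').div_const 2
    have h₂ := ((h₀.div_const s).arctan).const_mul (c / s)
    refine (h₁.sub h₂).congr_deriv ?_
    simp only [Pi.pow_apply]
    have := (hpos r).ne'
    have h₃ : 1 + ((r + c) / s) ^ 2 = (s ^ 2 + (r + c) ^ 2) / s ^ 2 := by field_simp
    rw [h₃]
    field_simp
    simp
    ring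
  · exact continuous_id.mul (continuous_const.div (by fun_prop) fun r => (hpos r).ne')

/-- The sum of `1 / (l + |n|²)` over the lattice points of norm at most `N`. -/
noncomputable def resolventSum (N l : ℝ) : ℝ :=
  ∑ n ∈ latticeBall N, 1 / (l + ((n.1 : ℝ) ^ 2 + (n.2 : ℝ) ^ 2))

lemma resolventSum_eq (N l : ℝ) :
    resolventSum N l = ∑ n ∈ latticeBall N, 1 / (l + radius (n.1, n.2) ^ 2) := by
  simp only [resolventSum, radius_sq]

lemma resolventSum_anti (N : ℝ) {l l' : ℝ} (hl : 0 < l) (h : l ≤ l') :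
    resolventSum N l' ≤ resolventSum N l :=
  Finset.sum_le_sum fun n _ => one_div_le_one_div_of_le (by positivity) (by linarith)

lemma resolventSum_le {N l : ℝ} (hN : 1 ≤ N) (hl : 5 ≤ l) :
    resolventSum N l ≤ 2 * Real.pi * Real.log N + 2 * Real.pi * (1 + 2 * Real.pi) := by
  rw [resolventSum_eq]
  have hint := integral_mul_inv_sq_add_sq one_pos (-2) 0 (N + 2)
  refine (sum_latticeBall_le (f := fun m => 1 / (l + m ^ 2))
    (g := fun r => 1 / (1 ^ 2 + (r + -2) ^ 2)) (by linarith) ?_ (fun r => by positivity) ?_).trans ?_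
  · exact continuous_const.div (by fun_prop) fun r => by positivity
  · intro m r hm hr h
    refine one_div_le_one_div_of_le (by positivity) ?_
    have h := (abs_le.1 h).2
    rcases le_total r 2 with h2 | h2 <;> nlinarith
  · rw [hint, ← mul_add]
    refine mul_le_mul_of_nonneg_left ?_ (by positivity)
    have h₁ : Real.log (1 ^ 2 + (N + 2 + -2) ^ 2) ≤ 2 * Real.log N + 1 := by
      have : Real.log (2 * N ^ 2) = Real.log 2 + 2 * Real.log N := by
        rw [Real.log_mul (by norm_num) (by positivity), Real.log_pow]; norm_num
      have h' : Real.log (1 ^ 2 + (N + 2 + -2) ^ 2) ≤ Real.log (2 * N ^ 2) :=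
        Real.log_le_log (by positivity) (by nlinarith)
      linarith [Real.log_two_lt_d9]
    have h₂ : 0 ≤ Real.log (1 ^ 2 + (0 + -2) ^ 2) := Real.log_nonneg (by norm_num)
    have h₃ := Real.arctan_lt_pi_div_two ((N + 2 + -2) / 1)
    have h₄ := Real.neg_pi_div_two_lt_arctan ((0 + -2) / 1)
    generalize Real.arctan ((N + 2 + -2) / 1) = x at *
    generalize Real.arctan ((0 + -2) / 1) = y at *
    generalize Real.log (1 ^ 2 + (0 + -2) ^ 2) = z at *
    generalize Real.log (1 ^ 2 + (N + 2 + -2) ^ 2) = w at *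
    clear hint
    norm_num
    linarith

lemma le_resolventSum {N l : ℝ} (hN : 2 ≤ N) (hl : 1 ≤ l) :
    2 * Real.pi * Real.log N - Real.pi * Real.log (l + 4) - 2 * Real.pi ^ 2 ≤
      resolventSum N l := by
  rw [resolventSum_eq]
  have hs : 1 ≤ √l := Real.one_le_sqrt.2 hl
  have hint := integral_mul_inv_sq_add_sq (by positivity : 0 < √l) 2 0 (N - 2)
  rw [Real.sq_sqrt (by positivity)] at hint
  refine le_trans ?_ (le_sum_latticeBall (f := fun m => 1 / (l + m ^ 2))
    (g := fun r => 1 / (l + (r + 2) ^ 2)) hN ?_ (fun r => by positivity) ?_)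
  · rw [hint]
    have h₁ : 2 * Real.log N ≤ Real.log (l + (N - 2 + 2) ^ 2) := by
      have : Real.log (N ^ 2) = 2 * Real.log N := by rw [Real.log_pow]; norm_num
      rw [← this]
      exact Real.log_le_log (by positivity) (by nlinarith)
    have h₂ : Real.log (l + (0 + 2) ^ 2) = Real.log (l + 4) := by norm_num
    have h₃ : 2 / √l * Real.arctan ((N - 2 + 2) / √l) ≤ 2 * (Real.pi / 2) := by
      refine mul_le_mul ((div_le_iff₀ (by positivity)).2 (by linarith))
        (Real.arctan_lt_pi_div_two _).le (Real.arctan_nonneg.2 ?_) (by norm_num)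
      exact div_nonneg (by linarith) (by positivity)
    have h₄ : 0 ≤ 2 / √l * Real.arctan ((0 + 2) / √l) :=
      mul_nonneg (by positivity) (Real.arctan_nonneg.2 (by positivity))
    rw [h₂]
    have := Real.pi_pos
    nlinarith
  · exact continuous_const.div (by fun_prop) fun r => by positivity
  · intro m r hm hr h
    refine one_div_le_one_div_of_le (by positivity) ?_
    have h := (abs_le.1 h).1
    nlinarith

theorem stmt2 (α : ℕ → ℝ) (lam : ℕ → ℝ)
    (hbdd : ∃ M : ℝ, ∀ N, |α N| ≤ M)
    (hne : ∀ N, α N ≠ 0)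
    (hdiv : Filter.Tendsto (fun N : ℕ => (α N) ^ 2 * Real.log N) Filter.atTop Filter.atTop)
    (hlam : ∀ N : ℕ, 0 < lam N ∧
      lam N = (3 * (α N) ^ 2 / (8 * Real.pi ^ 2)) *
        ∑ n ∈ latticeBall (N : ℝ), 1 / (lam N + ((n.1 : ℝ) ^ 2 + (n.2 : ℝ) ^ 2))) :
    ∃ C > (0 : ℝ), ∃ N₀ : ℕ, 3 ≤ N₀ ∧ ∀ N, N₀ ≤ N →
      |lam N - 3 / (4 * Real.pi) * (α N) ^ 2 * Real.log N|
        ≤ C * (α N) ^ 2 * Real.log (Real.log N) := by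
  obtain ⟨M, hM⟩ := hbdd
  have hπ := Real.pi_pos
  set k : ℕ → ℝ := fun N => 3 * (α N) ^ 2 / (8 * Real.pi ^ 2) with hk
  have hkpos : ∀ N, 0 < k N := fun N => by
    have := hne N
    simp only [hk]; positivity
  set K : ℝ := 3 * M ^ 2 / (8 * Real.pi ^ 2) with hK
  have hK₀ : 0 ≤ K := by positivity
  have hkK : ∀ N, k N ≤ K := fun N => by
    have : α N ^ 2 ≤ M ^ 2 := sq_le_sq' (abs_le.1 (hM N)).1 (abs_le.1 (hM N)).2
    simp only [hk, hK]; gcongr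
  have hlam' : ∀ N : ℕ, lam N = k N * resolventSum N (lam N) := fun N => (hlam N).2
  have hmain : ∀ N : ℕ, 3 / (4 * Real.pi) * (α N) ^ 2 * Real.log N =
      k N * (2 * Real.pi * Real.log N) := fun N => by
    simp only [hk]; field_simp; ring
  set A : ℝ := 2 * Real.pi * (1 + 2 * Real.pi)
  have hA : 0 ≤ A := by positivity
  set B : ℝ := Real.pi * Real.log (5 + 4) + 2 * Real.pi ^ 2
  have hB : 0 ≤ B := add_nonneg (mul_nonneg hπ.le (Real.log_nonneg (by norm_num))) (by positivity)
  set L : ℝ := K * (2 * Real.pi + A) + 4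
  have hL : 1 ≤ L := by
    have : 0 ≤ K * (2 * Real.pi + A) := by positivity
    simp only [L]; linarith
  have hlogL : 0 ≤ Real.log L := Real.log_nonneg hL
  set D : ℝ := A + Real.pi * Real.log L + 2 * Real.pi ^ 2 + Real.pi
  have hD : 0 < D := by positivity
  have hloglog : Filter.Tendsto (fun N : ℕ => Real.log (Real.log N)) Filter.atTop Filter.atTop :=
    Real.tendsto_log_atTop.comp (Real.tendsto_log_atTop.comp tendsto_natCast_atTop_atTop)
  have hlog : Filter.Tendsto (fun N : ℕ => Real.log N) Filter.atTop Filter.atTop :=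
    Real.tendsto_log_atTop.comp tendsto_natCast_atTop_atTop
  have hev : ∀ᶠ N : ℕ in Filter.atTop, 3 ≤ N ∧ 1 ≤ Real.log N ∧ 1 ≤ Real.log (Real.log N) ∧
      (5 + K * B) * (4 * Real.pi / 3) ≤ (α N) ^ 2 * Real.log N := by
    filter_upwards [Filter.eventually_ge_atTop 3, hlog.eventually_ge_atTop 1,
      hloglog.eventually_ge_atTop 1, hdiv.eventually_ge_atTop _] with N h₁ h₂ h₃ h₄
    exact ⟨h₁, h₂, h₃, h₄⟩
  obtain ⟨N₀, hN₀⟩ := Filter.eventually_atTop.1 hev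
  refine ⟨3 / (8 * Real.pi ^ 2) * D, by positivity, N₀, (hN₀ N₀ le_rfl).1, fun N hN => ?_⟩
  obtain ⟨h3, hl1, hll1, hα⟩ := hN₀ N hN
  have h3' : (3 : ℝ) ≤ N := by exact_mod_cast h3
  have hkN := hkpos N
  have hlarge : 5 ≤ lam N := by
    by_contra! hlt
    have h₁ := (le_resolventSum (by linarith : (2 : ℝ) ≤ N) (by norm_num : (1 : ℝ) ≤ 5)).trans
      (resolventSum_anti N (hlam N).1 hlt.le)
    have h₂ : k N * (2 * Real.pi * Real.log N - B) ≤ lam N := by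
      conv_rhs => rw [hlam' N]
      exact mul_le_mul_of_nonneg_left (by simp only [B]; linarith) hkN.le
    have h₃ : k N * B ≤ K * B := mul_le_mul_of_nonneg_right (hkK N) hB
    have h₄ : 5 + K * B ≤ 3 / (4 * Real.pi) * (α N) ^ 2 * Real.log N := by
      rw [← le_div_iff₀ (by positivity)] at hα
      refine hα.trans_eq ?_
      field_simp
    rw [hmain] at h₄
    linarith
  have hup := resolventSum_le (by linarith : (1 : ℝ) ≤ N) hlarge
  have hlow := le_resolventSum (by linarith : (2 : ℝ) ≤ N) (by linarith : 1 ≤ lam N)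
  have hlam_le : lam N + 4 ≤ L * Real.log N := by
    have h₁ : lam N ≤ K * (2 * Real.pi * Real.log N + A) := by
      conv_lhs => rw [hlam' N]
      exact (mul_le_mul_of_nonneg_left hup hkN.le).trans
        (mul_le_mul_of_nonneg_right (hkK N) (by positivity))
    have h₂ : K * A ≤ K * A * Real.log N := le_mul_of_one_le_right (by positivity) hl1
    simp only [L]
    linarith
  have hlog_le : Real.log (lam N + 4) ≤ Real.log L + Real.log (Real.log N) := by
    rw [← Real.log_mul (by positivity) (by positivity)]
    exact Real.log_le_log (by linarith) hlam_le
  have hdiff : |resolventSum N (lam N) - 2 * Real.pi * Real.log N| ≤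
      D * Real.log (Real.log N) := by
    have h₁ : A + Real.pi * Real.log L + 2 * Real.pi ^ 2 ≤
        (A + Real.pi * Real.log L + 2 * Real.pi ^ 2) * Real.log (Real.log N) :=
      le_mul_of_one_le_right (by positivity) hll1
    have h₂ := mul_le_mul_of_nonneg_left hlog_le hπ.le
    have h₃ : 0 ≤ Real.pi * Real.log L := by positivity
    have h₄ : 0 ≤ Real.pi * Real.log (Real.log N) := by positivity
    have h₅ : 0 ≤ Real.pi ^ 2 := by positivity
    simp only [D]
    rw [abs_le]
    constructor <;> linarith
  rw [hmain]
  conv_lhs => rw [hlam' N]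
  rw [← mul_sub, abs_mul, abs_of_pos hkN]
  refine (mul_le_mul_of_nonneg_left hdiff hkN.le).trans_eq ?_
  simp only [hk]
  ring
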